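/- Let K and J be finite nonempty sets, R : K → ℝ with R(k) ≥ 0 for all k, w : K → ℝ, c : J → ℝ, r : J → ℝ with r(j) > 0 for all j, and V ∈ ℝ. Then max over k ∈ K of [ sup over μ : J → ℝ with μ(j) ≥ 0 and ∑_{j ∈ J} μ(j)·r(j) ≤ R(k) of ( ∑_{j ∈ J} μ(j)·c(j) − V·w(k) ) ] equals max over (k, j) ∈ K × J of ( (R(k)/r(j))·max(c(j), 0) − V·w(k) ). -/

import Mathlib

/-- Under a single budget constraint, a linear objective is maximized by spending the whole budget
on one commodity with the best gain per unit of budget, or nothing if no gain is positive. -/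
theorem isGreatest_linear_budget {J : Type*} [Fintype J] [Nonempty J]
    {B : ℝ} (hB : 0 ≤ B) (c : J → ℝ) {r : J → ℝ} (hr : ∀ j, 0 < r j) (d : ℝ) :
    IsGreatest {y : ℝ | ∃ μ : J → ℝ,
        (∀ j, 0 ≤ μ j) ∧ (∑ j, μ j * r j) ≤ B ∧ y = (∑ j, μ j * c j) - d}
      (Finset.univ.sup' Finset.univ_nonempty fun j => B / r j * max (c j) 0 - d) := by
  classical
  constructor
  · obtain ⟨j, -, hj⟩ := Finset.exists_mem_eq_sup' Finset.univ_nonempty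
      fun j => B / r j * max (c j) 0 - d
    rw [hj]
    rcases le_total 0 (c j) with h | h
    · refine ⟨Pi.single j (B / r j), ?_, ?_, ?_⟩
      · have h_nonneg : (0 : J → ℝ) ≤ Pi.single j (B / r j) :=
          Pi.single_nonneg.2 (div_nonneg hB (hr j).le)
        exact h_nonneg
      · simp [Pi.single_apply, ite_mul, (hr j).ne']
      · simp [Pi.single_apply, ite_mul, h]
    · exact ⟨0, by simp, by simpa using hB, by simp [h]⟩
  · rintro _ ⟨μ, hμ, hμB, rfl⟩
    obtain ⟨j, hj⟩ := Finite.exists_max fun j => max (c j) 0 / r j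
    refine le_trans ?_ (Finset.le_sup' _ (Finset.mem_univ j))
    refine sub_le_sub_right ?_ d
    calc ∑ i, μ i * c i ≤ ∑ i, μ i * r i * (max (c j) 0 / r j) := by
          refine Finset.sum_le_sum fun i _ => ?_
          rw [mul_assoc]
          refine mul_le_mul_of_nonneg_left ((le_max_left _ 0).trans ?_) (hμ i)
          exact (div_le_iff₀' (hr i)).1 (hj i)
      _ = (∑ i, μ i * r i) * (max (c j) 0 / r j) := (Finset.sum_mul ..).symm
      _ ≤ B * (max (c j) 0 / r j) :=
          mul_le_mul_of_nonneg_right hμB (div_nonneg (le_max_right _ _) (hr j).le)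
      _ = B / r j * max (c j) 0 := by ring

theorem processing_optimality_lemma
    {K J : Type*} [Fintype K] [Fintype J] [Nonempty K] [Nonempty J]
    (R : K → ℝ) (hR : ∀ k, 0 ≤ R k) (w : K → ℝ)
    (c : J → ℝ) (r : J → ℝ) (hr : ∀ j, 0 < r j) (V : ℝ) :
    Finset.univ.sup' Finset.univ_nonempty
        (fun k : K => sSup {y : ℝ | ∃ μ : J → ℝ,
          (∀ j, 0 ≤ μ j) ∧ (∑ j, μ j * r j) ≤ R k ∧
          y = (∑ j, μ j * c j) - V * w k}) =
      Finset.univ.sup' Finset.univ_nonempty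
        (fun p : K × J => R p.1 / r p.2 * max (c p.2) 0 - V * w p.1) := by
  rw [Finset.sup'_congr _ rfl fun k _ =>
    (isGreatest_linear_budget (hR k) c hr (V * w k)).csSup_eq]
  exact (Finset.sup'_product_left (s := Finset.univ) (t := Finset.univ)
    (Finset.univ_nonempty.product Finset.univ_nonempty)
    fun p : K × J => R p.1 / r p.2 * max (c p.2) 0 - V * w p.1).symm
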